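/- arXiv:1908.00412 — 6 statements merged into one kernel-verified Lean document; each statement's English description precedes it below -/
import Mathlib

section
/- Let d ≥ 1, T > 0, A a real d×d matrix, B, D ∈ ℝ^d, Q and P symmetric positive semidefinite d×d matrices, and N > 0. Suppose K : [0,T] → (symmetric d×d matrices) is differentiable and satisfies the Riccati matrix differential equation K̇(t) + AᵀK(t) + K(t)A + Q − K(t)BBᵀK(t)/(N + DᵀK(t)D) = 0 for all t ∈ [0,T], with K(T) = P and N + DᵀK(t)D > 0 for all t ∈ [0,T]. Then u(t,x) := xᵀK(t)x satisfies, for all (t,x) ∈ [0,T] × ℝ^d, the Hamilton–Jacobi–Bellman equation ∂_t u(t,x) + inf_{a∈ℝ}[ (Ax + aB)·D_xu(t,x) + (a²/2)·tr(DDᵀ D_x²u(t,x)) + xᵀQx + N a² ] = 0, together with the terminal condition u(T,x) = xᵀPx. -/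
open Matrix

attribute [local instance] Matrix.normedAddCommGroup Matrix.normedSpace

theorem aux_fderiv {d : ℕ} (M : Matrix (Fin d) (Fin d) ℝ) (hM : M.IsSymm) (x v : Fin d → ℝ) :
    fderiv ℝ (fun y : Fin d → ℝ => y ⬝ᵥ (M *ᵥ y)) x v = 2 * (v ⬝ᵥ (M *ᵥ x)) := by
  have hd : DifferentiableAt ℝ (fun y : Fin d → ℝ => y ⬝ᵥ (M *ᵥ y)) x := by
    unfold dotProduct mulVec dotProduct
    fun_prop
  rw [← hd.lineDeriv_eq_fderiv]
  apply HasLineDerivAt.lineDeriv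
  unfold HasLineDerivAt
  have hs : x ⬝ᵥ (M *ᵥ v) = v ⬝ᵥ (M *ᵥ x) := by
    rw [dotProduct_mulVec, ← mulVec_transpose, hM.eq, dotProduct_comm]
  have e : (fun t : ℝ => (x + t • v) ⬝ᵥ (M *ᵥ (x + t • v))) = fun t : ℝ =>
      x ⬝ᵥ (M *ᵥ x) + t * (2 * (v ⬝ᵥ (M *ᵥ x))) + t ^ 2 * (v ⬝ᵥ (M *ᵥ v)) := by
    funext t
    simp only [mulVec_add, mulVec_smul, dotProduct_add, add_dotProduct, smul_dotProduct,
      dotProduct_smul, smul_eq_mul, hs]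
    ring
  rw [e]
  have h := (((hasDerivAt_id (0:ℝ)).mul_const (2 * (v ⬝ᵥ (M *ᵥ x)))).const_add
    (x ⬝ᵥ (M *ᵥ x))).add (((hasDerivAt_id (0:ℝ)).pow 2).mul_const (v ⬝ᵥ (M *ᵥ v)))
  convert h using 1
  · funext y
    simp
  · simp

theorem aux_lin {d : ℕ} (M : Matrix (Fin d) (Fin d) ℝ) (w x v : Fin d → ℝ) :
    fderiv ℝ (fun y : Fin d → ℝ => 2 * (w ⬝ᵥ (M *ᵥ y))) x v = 2 * (w ⬝ᵥ (M *ᵥ v)) := by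
  let L : (Fin d → ℝ) →ₗ[ℝ] ℝ :=
    { toFun := fun y => 2 * (w ⬝ᵥ (M *ᵥ y))
      map_add' := by intro a b; simp only [mulVec_add, dotProduct_add]; ring
      map_smul' := by
        intro a b; simp only [mulVec_smul, dotProduct_smul, smul_eq_mul, RingHom.id_apply]; ring }
  have h := (LinearMap.toContinuousLinearMap L).fderiv (x := x)
  exact congrArg (fun F : (Fin d → ℝ) →L[ℝ] ℝ => F v) h

theorem aux_time {d : ℕ} (K : ℝ → Matrix (Fin d) (Fin d) ℝ) (K' : Matrix (Fin d) (Fin d) ℝ)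
    (t : ℝ) (h : HasDerivAt K K' t) (x : Fin d → ℝ) :
    HasDerivAt (fun s => x ⬝ᵥ (K s *ᵥ x)) (x ⬝ᵥ (K' *ᵥ x)) t := by
  let L : Matrix (Fin d) (Fin d) ℝ →ₗ[ℝ] ℝ :=
    { toFun := fun M => x ⬝ᵥ (M *ᵥ x)
      map_add' := by intro a b; simp only [add_mulVec, dotProduct_add]
      map_smul' := by
        intro a b; simp only [smul_mulVec, dotProduct_smul, RingHom.id_apply] }
  exact (LinearMap.toContinuousLinearMap L).hasFDerivAt.comp_hasDerivAt t h

theorem aux_inf (c b r : ℝ) (hr : 0 < r) :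
    sInf (Set.range fun a : ℝ => c + 2 * a * b + r * a ^ 2) = c - r⁻¹ * b ^ 2 := by
  apply IsLeast.csInf_eq
  constructor
  · refine ⟨-(b / r), ?_⟩
    field_simp
    ring
  · rintro _ ⟨a, rfl⟩
    have : c + 2 * a * b + r * a ^ 2 - (c - r⁻¹ * b ^ 2) = r * (a + b / r) ^ 2 := by
      field_simp
      ring
    have h2 : 0 ≤ r * (a + b / r) ^ 2 := by positivity
    simp only
    linarith

theorem stmt_3 (d : ℕ) (hd : 1 ≤ d) (T : ℝ) (hT : 0 < T)
    (A : Matrix (Fin d) (Fin d) ℝ) (B D : Fin d → ℝ)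
    (Q P : Matrix (Fin d) (Fin d) ℝ)
    (hQ : Q.PosSemidef) (hP : P.PosSemidef)
    (N : ℝ) (hN : 0 < N)
    (K K' : ℝ → Matrix (Fin d) (Fin d) ℝ)
    (hKsymm : ∀ t ∈ Set.Icc (0:ℝ) T, (K t).IsSymm)
    (hKderiv : ∀ t ∈ Set.Icc (0:ℝ) T, HasDerivAt K (K' t) t)
    (hRiccati : ∀ t ∈ Set.Icc (0:ℝ) T,
      K' t + Aᵀ * K t + K t * A + Q
        - (N + D ⬝ᵥ (K t *ᵥ D))⁻¹ • (K t * vecMulVec B B * K t) = 0)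
    (hdenom : ∀ t ∈ Set.Icc (0:ℝ) T, 0 < N + D ⬝ᵥ (K t *ᵥ D))
    (hKT : K T = P)
    (u : ℝ → (Fin d → ℝ) → ℝ)
    (hu : ∀ t x, u t x = x ⬝ᵥ (K t *ᵥ x)) :
    (∀ t ∈ Set.Icc (0:ℝ) T, ∀ x : Fin d → ℝ,
      deriv (fun s => u s x) t
        + sInf (Set.range fun a : ℝ =>
            (A *ᵥ x + a • B) ⬝ᵥ (fun i => fderiv ℝ (u t) x (Pi.single i 1))
            + a ^ 2 / 2 * Matrix.trace (vecMulVec D D *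
                Matrix.of (fun i j =>
                  fderiv ℝ (fun y => fderiv ℝ (u t) y (Pi.single j 1)) x (Pi.single i 1)))
            + x ⬝ᵥ (Q *ᵥ x) + N * a ^ 2) = 0) ∧
    (∀ x : Fin d → ℝ, u T x = x ⬝ᵥ (P *ᵥ x)) := by
  refine ⟨fun t ht x => ?_, fun x => by rw [hu, hKT]⟩
  have hS := hKsymm t ht
  have hut : u t = fun y => y ⬝ᵥ (K t *ᵥ y) := funext (hu t)
  have h1 : deriv (fun s => u s x) t = x ⬝ᵥ (K' t *ᵥ x) := by
    simp only [hu]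
    exact (aux_time K (K' t) t (hKderiv t ht) x).deriv
  have hg : (fun i => 2 * ((Pi.single i 1 : Fin d → ℝ) ⬝ᵥ (K t *ᵥ x))) =
      (2:ℝ) • (K t *ᵥ x) := by
    funext i
    simp
  have hH : (Matrix.of fun i j => 2 * ((Pi.single j 1 : Fin d → ℝ) ⬝ᵥ
      (K t *ᵥ (Pi.single i 1 : Fin d → ℝ)))) = (2:ℝ) • K t := by
    ext i j
    simp [hS.apply i j]
  have hs : ∀ v w : Fin d → ℝ, v ⬝ᵥ (K t *ᵥ w) = w ⬝ᵥ (K t *ᵥ v) := by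
    intro v w
    rw [dotProduct_mulVec, ← mulVec_transpose, hS.eq, dotProduct_comm]
  have htr : Matrix.trace (vecMulVec D D * ((2:ℝ) • K t)) = 2 * (D ⬝ᵥ (K t *ᵥ D)) := by
    rw [vecMulVec_mul, trace_vecMulVec, ← mulVec_transpose, transpose_smul, hS.eq, smul_mulVec,
      dotProduct_smul, smul_eq_mul]
  rw [h1, hut]
  simp only [aux_fderiv _ hS, aux_lin]
  rw [hg, hH, htr]
  have hfun : (fun a : ℝ => (A *ᵥ x + a • B) ⬝ᵥ ((2:ℝ) • (K t *ᵥ x))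
      + a ^ 2 / 2 * (2 * (D ⬝ᵥ (K t *ᵥ D))) + x ⬝ᵥ (Q *ᵥ x) + N * a ^ 2) = fun a : ℝ =>
      (2 * ((A *ᵥ x) ⬝ᵥ (K t *ᵥ x)) + x ⬝ᵥ (Q *ᵥ x)) + 2 * a * (B ⬝ᵥ (K t *ᵥ x))
        + (N + D ⬝ᵥ (K t *ᵥ D)) * a ^ 2 := by
    funext a
    simp only [add_dotProduct, smul_dotProduct, dotProduct_smul, smul_eq_mul]
    ring
  rw [hfun, aux_inf _ _ _ (hdenom t ht)]
  have hR := congrArg (fun M : Matrix (Fin d) (Fin d) ℝ => x ⬝ᵥ (M *ᵥ x)) (hRiccati t ht)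
  simp only [sub_mulVec, add_mulVec, smul_mulVec, dotProduct_add, dotProduct_sub,
    dotProduct_smul, smul_eq_mul, zero_mulVec, dotProduct_zero] at hR
  have e1 : x ⬝ᵥ ((Aᵀ * K t) *ᵥ x) = (A *ᵥ x) ⬝ᵥ (K t *ᵥ x) := by
    rw [← mulVec_mulVec, dotProduct_mulVec, vecMul_transpose]
  have e2 : x ⬝ᵥ ((K t * A) *ᵥ x) = (A *ᵥ x) ⬝ᵥ (K t *ᵥ x) := by
    rw [← mulVec_mulVec, hs]
  have e3 : x ⬝ᵥ ((K t * vecMulVec B B * K t) *ᵥ x) = (B ⬝ᵥ (K t *ᵥ x)) ^ 2 := by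
    have : vecMulVec B B *ᵥ (K t *ᵥ x) = (B ⬝ᵥ (K t *ᵥ x)) • B := by
      ext i
      rw [vecMulVec_mulVec]
      simp [mul_comm]
    rw [← mulVec_mulVec, ← mulVec_mulVec, this, mulVec_smul, dotProduct_smul, smul_eq_mul, hs x B]
    ring
  rw [e1, e2, e3] at hR
  linarith
end

section
/- Let η > 0, λ, κ, θ, ν ∈ ℝ, ρ ∈ (−1,1), T > 0, and set κ̄ := κ + ρνλ. Suppose φ, ψ, χ : [0,T] → ℝ are differentiable and satisfy the Riccati system: φ'(t) = 2κ̄φ(t) + ν²(1−ρ²)φ(t)² − λ², ψ'(t) = (κ̄ + ν²(1−ρ²)φ(t))ψ(t) − κθφ(t), χ'(t) = −κθψ(t) + (ν²/2)(−φ(t) + (1−ρ²)ψ(t)²), with φ(T) = ψ(T) = χ(T) = 0. Define u : [0,T] × ℝ × ℝ → ℝ by u(t,x,v) = −exp(−ηx)·exp(−φ(t)v²/2 − ψ(t)v − χ(t)). Then ∂²_{xx}u(t,x,v) = η²u(t,x,v) < 0 everywhere, u(T,x,v) = −e^{−ηx}, and u satisfies the Hamilton–Jacobi–Bellman equation ∂_t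 u + κ(θ−v)∂_v u + (1/2)ν² ∂²_{vv}u = (1/2)λ²v²·(∂_x u)²/∂²_{xx}u + ρλvν·(∂_x u·∂²_{xv}u)/∂²_{xx}u + (1/2)ρ²ν²·(∂²_{xv}u)²/∂²_{xx}u for all (t,x,v) ∈ [0,T] × ℝ × ℝ. -/
theorem stmt_11 (η lam κ θ ν ρ T : ℝ) (hη : 0 < η) (hρ : ρ ∈ Set.Ioo (-1 : ℝ) 1)
    (hT : 0 < T) (κb : ℝ) (hκb : κb = κ + ρ * ν * lam)
    (φ ψ χ : ℝ → ℝ)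
    (hφ : ∀ t ∈ Set.Icc (0:ℝ) T,
      HasDerivAt φ (2 * κb * φ t + ν ^ 2 * (1 - ρ ^ 2) * (φ t) ^ 2 - lam ^ 2) t)
    (hψ : ∀ t ∈ Set.Icc (0:ℝ) T,
      HasDerivAt ψ ((κb + ν ^ 2 * (1 - ρ ^ 2) * φ t) * ψ t - κ * θ * φ t) t)
    (hχ : ∀ t ∈ Set.Icc (0:ℝ) T,
      HasDerivAt χ (-(κ * θ) * ψ t + ν ^ 2 / 2 * (-(φ t) + (1 - ρ ^ 2) * (ψ t) ^ 2)) t)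
    (hφT : φ T = 0) (hψT : ψ T = 0) (hχT : χ T = 0)
    (u : ℝ → ℝ → ℝ → ℝ)
    (hu : ∀ t x v, u t x v
      = -Real.exp (-η * x) * Real.exp (-(φ t) * v ^ 2 / 2 - ψ t * v - χ t)) :
    (∀ (t x v : ℝ), deriv (fun y => deriv (fun z => u t z v) y) x = η ^ 2 * u t x v
        ∧ η ^ 2 * u t x v < 0) ∧
    (∀ x v : ℝ, u T x v = -Real.exp (-η * x)) ∧
    (∀ t ∈ Set.Icc (0:ℝ) T, ∀ x v : ℝ,
      deriv (fun s => u s x v) t + κ * (θ - v) * deriv (fun w => u t x w) v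
          + 1 / 2 * ν ^ 2 * deriv (fun w => deriv (fun w' => u t x w') w) v
        = 1 / 2 * lam ^ 2 * v ^ 2 * (deriv (fun y => u t y v) x) ^ 2
              / deriv (fun y => deriv (fun z => u t z v) y) x
          + ρ * lam * v * ν * (deriv (fun y => u t y v) x
                * deriv (fun w => deriv (fun y => u t y w) x) v)
              / deriv (fun y => deriv (fun z => u t z v) y) x
          + 1 / 2 * ρ ^ 2 * ν ^ 2 * (deriv (fun w => deriv (fun y => u t y w) x) v) ^ 2
              / deriv (fun y => deriv (fun z => u t z v) y) x) := by
  have hux : ∀ t x v, HasDerivAt (fun y => u t y v) (-η * u t x v) x := by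
    intro t x v
    have h1 : HasDerivAt (fun y : ℝ => -η * y) (-η) x := by
      simpa using (hasDerivAt_id x).const_mul (-η)
    have h2 := (h1.exp.neg).mul_const (Real.exp (-(φ t) * v ^ 2 / 2 - ψ t * v - χ t))
    have h3 : (fun y => u t y v) = fun y => -Real.exp (-η * y)
        * Real.exp (-(φ t) * v ^ 2 / 2 - ψ t * v - χ t) := funext fun y => hu t y v
    rw [h3, hu]
    refine HasDerivAt.congr_deriv h2 ?_
    ring
  have huv : ∀ t x v, HasDerivAt (fun w => u t x w) (-(φ t * v + ψ t) * u t x v) v := by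
    intro t x v
    have h0 : HasDerivAt (fun w : ℝ => -(φ t) * w ^ 2 / 2 - ψ t * w - χ t)
        (-(φ t * v + ψ t)) v := by
      have := ((((hasDerivAt_pow 2 v).const_mul (-(φ t))).div_const 2).sub
        ((hasDerivAt_id v).const_mul (ψ t))).sub_const (χ t)
      refine HasDerivAt.congr_deriv this ?_
      norm_num
      ring
    have h2 := h0.exp.const_mul (-Real.exp (-η * x))
    have h3 : (fun w => u t x w) = fun w => -Real.exp (-η * x)
        * Real.exp (-(φ t) * w ^ 2 / 2 - ψ t * w - χ t) := funext fun w => hu t x w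
    rw [h3, hu]
    refine HasDerivAt.congr_deriv h2 ?_
    ring
  have hdx : ∀ t x v, deriv (fun y => u t y v) x = -η * u t x v := fun t x v => (hux t x v).deriv
  have hdv : ∀ t x v, deriv (fun w => u t x w) v = -(φ t * v + ψ t) * u t x v :=
    fun t x v => (huv t x v).deriv
  have hdxx : ∀ t x v, deriv (fun y => deriv (fun z => u t z v) y) x = η ^ 2 * u t x v := by
    intro t x v
    simp only [hdx]
    rw [((hux t x v).const_mul (-η)).deriv]
    ring
  have hdxv : ∀ t x v, deriv (fun w => deriv (fun y => u t y w) x) v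
      = η * (φ t * v + ψ t) * u t x v := by
    intro t x v
    simp only [hdx]
    rw [((huv t x v).const_mul (-η)).deriv]
    ring
  have hdvv : ∀ t x v, deriv (fun w => deriv (fun w' => u t x w') w) v
      = ((φ t * v + ψ t) ^ 2 - φ t) * u t x v := by
    intro t x v
    simp only [hdv]
    have h1 : HasDerivAt (fun w : ℝ => -(φ t * w + ψ t)) (-(φ t)) v := by
      refine HasDerivAt.congr_deriv
        ((((hasDerivAt_id v).const_mul (φ t)).add_const (ψ t)).neg) ?_
      ring
    refine ((h1.mul (huv t x v)).congr_deriv ?_).deriv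
    ring
  have hneg : ∀ t x v, u t x v < 0 := by
    intro t x v
    rw [hu]
    have := mul_pos (Real.exp_pos (-η * x))
      (Real.exp_pos (-(φ t) * v ^ 2 / 2 - ψ t * v - χ t))
    linarith
  refine ⟨fun t x v => ⟨hdxx t x v, mul_neg_of_pos_of_neg (by positivity) (hneg t x v)⟩, ?_, ?_⟩
  · intro x v
    simp [hu, hφT, hψT, hχT]
  · intro t ht x v
    have hdt : deriv (fun s => u s x v) t =
        -((2 * κb * φ t + ν ^ 2 * (1 - ρ ^ 2) * (φ t) ^ 2 - lam ^ 2) * v ^ 2 / 2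
          + ((κb + ν ^ 2 * (1 - ρ ^ 2) * φ t) * ψ t - κ * θ * φ t) * v
          + (-(κ * θ) * ψ t + ν ^ 2 / 2 * (-(φ t) + (1 - ρ ^ 2) * (ψ t) ^ 2))) * u t x v := by
      have h2 := ((((((hφ t ht).neg.mul_const (v ^ 2)).div_const 2).sub
        ((hψ t ht).mul_const v)).sub (hχ t ht)).exp).const_mul (-Real.exp (-η * x))
      have h3 : (fun s => u s x v) = fun s => -Real.exp (-η * x)
        * Real.exp (-(φ s) * v ^ 2 / 2 - ψ s * v - χ s) := funext fun s => hu s x v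
      rw [h3, hu]
      refine (HasDerivAt.congr_deriv h2 ?_).deriv
      simp only [Pi.sub_apply, Pi.neg_apply]
      ring
    have hne := (hneg t x v).ne
    have hη' := hη.ne'
    rw [hdt, hdvv, hdxx, hdxv, hdv, hdx, hκb]
    generalize u t x v = U at *
    field_simp
    ring
end

section
/- Let λ, κ, ν ∈ ℝ and ρ ∈ (−1,1), set κ̄ := κ + ρνλ and κ̂ := √(κ² + 2ρνλκ + ν²λ²), and note κ̂² = κ̄² + ν²(1−ρ²)λ². Assume κ̂ > 0, and let T > 0. Define φ : [0,T] → ℝ by φ(t) = λ²·sinh(κ̂(T−t)) / (κ̂·cosh(κ̂(T−t)) + κ̄·sinh(κ̂(T−t))). Then the denominator κ̂·cosh(κ̂(T−t)) + κ̄·sinh(κ̂(T−t)) is strictly positive for all t ∈ [0,T], φ is differentiable, and φ satisfies the Riccati ordinary differential equation φ'(t) = 2κ̄φ(t) + ν²(1−ρ²)φ(t)² − λ² for all t ∈ [0,T], with terminal condition φ(T) = 0. -/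
theorem stmt_12 (lam κ ν ρ : ℝ) (hρ : ρ ∈ Set.Ioo (-1 : ℝ) 1)
    (κb κh : ℝ) (hκb : κb = κ + ρ * ν * lam)
    (hκh : κh = Real.sqrt (κ ^ 2 + 2 * ρ * ν * lam * κ + ν ^ 2 * lam ^ 2))
    (hκhpos : 0 < κh) (T : ℝ) (hT : 0 < T)
    (φ : ℝ → ℝ)
    (hφ : ∀ t, φ t = lam ^ 2 * Real.sinh (κh * (T - t))
        / (κh * Real.cosh (κh * (T - t)) + κb * Real.sinh (κh * (T - t)))) :
    κh ^ 2 = κb ^ 2 + ν ^ 2 * (1 - ρ ^ 2) * lam ^ 2 ∧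
    (∀ t ∈ Set.Icc (0:ℝ) T,
      0 < κh * Real.cosh (κh * (T - t)) + κb * Real.sinh (κh * (T - t)) ∧
      HasDerivAt φ (2 * κb * φ t + ν ^ 2 * (1 - ρ ^ 2) * (φ t) ^ 2 - lam ^ 2) t) ∧
    φ T = 0 := by
  have hsq : κh ^ 2 = κb ^ 2 + ν ^ 2 * (1 - ρ ^ 2) * lam ^ 2 := by
    have hp : 0 < κ ^ 2 + 2 * ρ * ν * lam * κ + ν ^ 2 * lam ^ 2 := by
      rw [hκh] at hκhpos
      exact Real.sqrt_pos.mp hκhpos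
    rw [hκh, Real.sq_sqrt hp.le, hκb]
    ring
  refine ⟨hsq, ?_, ?_⟩
  · intro t ht
    have hs : 0 ≤ Real.sinh (κh * (T - t)) :=
      Real.sinh_nonneg_iff.mpr (mul_nonneg hκhpos.le (sub_nonneg.mpr ht.2))
    have hcs : Real.sinh (κh * (T - t)) < Real.cosh (κh * (T - t)) := Real.sinh_lt_cosh _
    have h1 : Real.cosh (κh * (T - t)) ^ 2 = Real.sinh (κh * (T - t)) ^ 2 + 1 := Real.cosh_sq _
    have hrho : 0 ≤ 1 - ρ ^ 2 := by nlinarith [hρ.1, hρ.2]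
    have hb : -κh ≤ κb := by
      refine (abs_le_of_sq_le_sq' ?_ hκhpos.le).1
      have : 0 ≤ ν ^ 2 * (1 - ρ ^ 2) * lam ^ 2 := by positivity
      linarith
    have hD : 0 < κh * Real.cosh (κh * (T - t)) + κb * Real.sinh (κh * (T - t)) := by
      have e1 := mul_le_mul_of_nonneg_right hb hs
      have e2 := mul_lt_mul_of_pos_left hcs hκhpos
      linarith
    refine ⟨hD, ?_⟩
    have hu : HasDerivAt (fun t => κh * (T - t)) (-κh) t := by
      simpa using ((hasDerivAt_id t).const_sub T).const_mul κh
    have hd := (hu.sinh.const_mul (lam ^ 2)).div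
      ((hu.cosh.const_mul κh).add (hu.sinh.const_mul κb)) hD.ne'
    have hf : φ = _ := funext hφ
    rw [hφ t, hf]
    refine hd.congr_deriv ?_
    simp only [Pi.add_apply]
    generalize Real.sinh (κh * (T - t)) = s at *
    generalize Real.cosh (κh * (T - t)) = c at *
    have hne := hD.ne'
    obtain ⟨D, hDe⟩ : ∃ D, D = κh * c + κb * s := ⟨_, rfl⟩
    rw [← hDe] at hne ⊢
    have hR : 2 * κb * (lam ^ 2 * s / D) + ν ^ 2 * (1 - ρ ^ 2) * (lam ^ 2 * s / D) ^ 2 - lam ^ 2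
        = (2 * κb * (lam ^ 2 * s) * D + ν ^ 2 * (1 - ρ ^ 2) * (lam ^ 2 * s) ^ 2
          - lam ^ 2 * D ^ 2) / D ^ 2 := by
      field_simp
    rw [hR]
    congr 1
    rw [hDe]
    linear_combination (lam ^ 2 * s ^ 2) * hsq
  · rw [hφ]; simp
end

section
/- Let λ, κ, θ, ν ∈ ℝ and ρ ∈ (−1,1), set κ̄ := κ + ρνλ and κ̂ := √(κ² + 2ρνλκ + ν²λ²), assume κ̂ > 0, and let T > 0. Define φ(t) = λ²·sinh(κ̂(T−t))/(κ̂·cosh(κ̂(T−t)) + κ̄·sinh(κ̂(T−t))) and ψ(t) = λ²·(κθ/κ̂)·(cosh(κ̂(T−t)) − 1)/(κ̂·cosh(κ̂(T−t)) + κ̄·sinh(κ̂(T−t))) for t ∈ [0,T]. Then ψ is differentiable and satisfies the linear ordinary differential equation ψ'(t) = (κ̄ + ν²(1−ρ²)φ(t))·ψ(t) − κθ·φ(t) for all t ∈ [0,T], with terminal condition ψ(T) = 0. -/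
theorem stmt_13 (lam κ θ ν ρ : ℝ) (hρ : ρ ∈ Set.Ioo (-1 : ℝ) 1)
    (κb κh : ℝ) (hκb : κb = κ + ρ * ν * lam)
    (hκh : κh = Real.sqrt (κ ^ 2 + 2 * ρ * ν * lam * κ + ν ^ 2 * lam ^ 2))
    (hκhpos : 0 < κh) (T : ℝ) (hT : 0 < T)
    (φ ψ : ℝ → ℝ)
    (hφ : ∀ t, φ t = lam ^ 2 * Real.sinh (κh * (T - t))
        / (κh * Real.cosh (κh * (T - t)) + κb * Real.sinh (κh * (T - t))))
    (hψ : ∀ t, ψ t = lam ^ 2 * (κ * θ / κh) * (Real.cosh (κh * (T - t)) - 1)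
        / (κh * Real.cosh (κh * (T - t)) + κb * Real.sinh (κh * (T - t)))) :
    (∀ t ∈ Set.Icc (0:ℝ) T,
      HasDerivAt ψ ((κb + ν ^ 2 * (1 - ρ ^ 2) * φ t) * ψ t - κ * θ * φ t) t) ∧
    ψ T = 0 := by
  have hnn : 0 ≤ κ ^ 2 + 2 * ρ * ν * lam * κ + ν ^ 2 * lam ^ 2 := by
    by_contra h
    rw [Real.sqrt_eq_zero_of_nonpos (by linarith)] at hκh
    linarith
  have hsq : κh ^ 2 = κb ^ 2 + ν ^ 2 * (1 - ρ ^ 2) * lam ^ 2 := by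
    rw [hκh, Real.sq_sqrt hnn, hκb]; ring
  have hm : 0 ≤ ν ^ 2 * (1 - ρ ^ 2) * lam ^ 2 := by
    have h1 : 0 ≤ 1 - ρ ^ 2 := by nlinarith [hρ.1, hρ.2]
    positivity
  have hge : -κh ≤ κb := (abs_le_of_sq_le_sq' (by linarith) hκhpos.le).1
  refine ⟨?_, by rw [hψ]; simp⟩
  intro t ht
  have hu : HasDerivAt (fun t : ℝ => κh * (T - t)) (-κh) t := by
    simpa using ((hasDerivAt_id t).const_sub T).const_mul κh
  have hC := hu.cosh
  have hS := hu.sinh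
  have hSnn : 0 ≤ Real.sinh (κh * (T - t)) :=
    Real.sinh_nonneg_iff.2 (mul_nonneg hκhpos.le (by linarith [ht.2]))
  have hlt := Real.sinh_lt_cosh (κh * (T - t))
  have hD : κh * Real.cosh (κh * (T - t)) + κb * Real.sinh (κh * (T - t)) ≠ 0 := by
    apply ne_of_gt
    nlinarith [mul_nonneg (by linarith : 0 ≤ κb + κh) hSnn, mul_pos hκhpos (sub_pos.2 hlt)]
  have hψ' : ψ = fun t => lam ^ 2 * (κ * θ / κh) * (Real.cosh (κh * (T - t)) - 1)
        / (κh * Real.cosh (κh * (T - t)) + κb * Real.sinh (κh * (T - t))) := funext hψ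
  have key := ((hC.sub_const 1).const_mul (lam ^ 2 * (κ * θ / κh))).fun_div
    ((hC.const_mul κh).fun_add (hS.const_mul κb)) hD
  rw [hφ t, hψ t, hψ']
  refine key.congr_deriv ?_
  generalize Real.cosh (κh * (T - t)) = C at *
  generalize Real.sinh (κh * (T - t)) = S at *
  have hk := hκhpos.ne'
  clear hκh key hC hS
  obtain ⟨D, hDe⟩ : ∃ D, D = κh * C + κb * S := ⟨_, rfl⟩
  rw [← hDe] at hD ⊢
  field_simp
  rw [hDe]
  linear_combination (lam ^ 2 * κ * θ * S * (C - 1)) * hsq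
end

section
/- Let n ≥ 1 be an integer, η > 0, T > 0, and for each i = 1,...,n let λ_i, κ_i, θ_i, ν_i ∈ ℝ. Suppose for each i that φ_i, ψ_i, χ_i : [0,T] → ℝ are differentiable and satisfy φ_i'(t) = 2κ_iφ_i(t) + ν_i²φ_i(t)² − λ_i², ψ_i'(t) = (κ_i + ν_i²φ_i(t))ψ_i(t) − κ_iθ_iφ_i(t), χ_i'(t) = −κ_iθ_iψ_i(t) + (ν_i²/2)(−φ_i(t) + ψ_i(t)²), with φ_i(T) = ψ_i(T) = χ_i(T) = 0. Define u : [0,T] × ℝ × ℝⁿ → ℝ by u(t,x,v) = −exp(−ηx)·exp(−Σᵢ[φ_i(t)v_i²/2 + ψ_i(t)v_i + χ_i(t)]). Then ∂²_{xx}u = η²u < 0 everywhere, u(T,x,v) = −e^{−ηx}, and u satisfies the no-leverage Hamilton–Jacobi–Bellman equation ∂_t u + Σᵢ[ κ_i(θ_i − v_i)∂_{v_i}u + (1/2)ν_i² ∂²_{v_iv_i}u ] = (1/2)(Σᵢ λ_i² v_i²)·(∂_x u)²/∂²_{xx}u for all (t,x,v) ∈ [0,T] × ℝ × ℝⁿ.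 -/
theorem stmt_17 (n : ℕ) (hn : 1 ≤ n) (η T : ℝ) (hη : 0 < η) (hT : 0 < T)
    (lam κ θ ν : Fin n → ℝ)
    (φ ψ χ : Fin n → ℝ → ℝ)
    (hφ : ∀ i, ∀ t ∈ Set.Icc (0:ℝ) T,
      HasDerivAt (φ i) (2 * κ i * φ i t + (ν i) ^ 2 * (φ i t) ^ 2 - (lam i) ^ 2) t)
    (hψ : ∀ i, ∀ t ∈ Set.Icc (0:ℝ) T,
      HasDerivAt (ψ i) ((κ i + (ν i) ^ 2 * φ i t) * ψ i t - κ i * θ i * φ i t) t)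
    (hχ : ∀ i, ∀ t ∈ Set.Icc (0:ℝ) T,
      HasDerivAt (χ i) (-(κ i * θ i) * ψ i t + (ν i) ^ 2 / 2 * (-(φ i t) + (ψ i t) ^ 2)) t)
    (hφT : ∀ i, φ i T = 0) (hψT : ∀ i, ψ i T = 0) (hχT : ∀ i, χ i T = 0)
    (u : ℝ → ℝ → (Fin n → ℝ) → ℝ)
    (hu : ∀ t x v, u t x v
      = -Real.exp (-η * x)
          * Real.exp (-(∑ i, (φ i t * (v i) ^ 2 / 2 + ψ i t * v i + χ i t)))) :
    (∀ t ∈ Set.Icc (0:ℝ) T, ∀ (x : ℝ) (v : Fin n → ℝ),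
      deriv (fun y => deriv (fun z => u t z v) y) x = η ^ 2 * u t x v
        ∧ η ^ 2 * u t x v < 0) ∧
    (∀ (x : ℝ) (v : Fin n → ℝ), u T x v = -Real.exp (-η * x)) ∧
    (∀ t ∈ Set.Icc (0:ℝ) T, ∀ (x : ℝ) (v : Fin n → ℝ),
      deriv (fun s => u s x v) t
        + ∑ i, (κ i * (θ i - v i) * fderiv ℝ (u t x) v (Pi.single i 1)
            + 1 / 2 * (ν i) ^ 2
              * fderiv ℝ (fun w => fderiv ℝ (u t x) w (Pi.single i 1)) v (Pi.single i 1))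
      = 1 / 2 * (∑ i, (lam i) ^ 2 * (v i) ^ 2) * (deriv (fun y => u t y v) x) ^ 2
          / deriv (fun y => deriv (fun z => u t z v) y) x) := by
  have hne : ∀ t x v, u t x v < 0 := by
    intro t x v
    rw [hu]
    have := mul_pos (Real.exp_pos (-η * x))
      (Real.exp_pos (-(∑ i, (φ i t * (v i) ^ 2 / 2 + ψ i t * v i + χ i t))))
    linarith
  have hx : ∀ t x v, HasDerivAt (fun z => u t z v) (-η * u t x v) x := by
    intro t x v
    simp only [hu]
    have h := ((((hasDerivAt_id x).const_mul (-η)).exp).neg).mul_const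
      (Real.exp (-(∑ i, (φ i t * (v i) ^ 2 / 2 + ψ i t * v i + χ i t))))
    refine h.congr_deriv ?_
    simp only [id]
    ring
  have hx1 : ∀ t x v, deriv (fun z => u t z v) x = -η * u t x v := fun t x v => (hx t x v).deriv
  have hx2 : ∀ t x v, deriv (fun y => deriv (fun z => u t z v) y) x = η ^ 2 * u t x v := by
    intro t x v
    simp only [hx1]
    rw [((hx t x v).const_mul (-η)).deriv]
    ring
  have hv : ∀ t x v, HasFDerivAt (u t x)
      ((-u t x v) • ∑ j, (φ j t * v j + ψ j t) •
        (ContinuousLinearMap.proj j : (Fin n → ℝ) →L[ℝ] ℝ)) v := by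
    intro t x v
    have e : u t x = fun v => -Real.exp (-η * x)
          * Real.exp (-(∑ i, (φ i t * (v i) ^ 2 / 2 + ψ i t * v i + χ i t))) := by
      funext v; exact hu t x v
    have hS : HasFDerivAt (fun v : Fin n → ℝ => ∑ i, (φ i t * (v i) ^ 2 / 2 + ψ i t * v i + χ i t))
        (∑ j, (φ j t * v j + ψ j t) •
        (ContinuousLinearMap.proj j : (Fin n → ℝ) →L[ℝ] ℝ)) v := by
      apply HasFDerivAt.fun_sum
      intro j _
      have h1 : HasDerivAt (fun y : ℝ => φ j t * y ^ 2 / 2 + ψ j t * y + χ j t)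
          (φ j t * v j + ψ j t) (v j) := by
        have := ((((hasDerivAt_pow 2 (v j)).const_mul (φ j t)).div_const 2).add
          ((hasDerivAt_id (v j)).const_mul (ψ j t))).add_const (χ j t)
        refine this.congr_deriv ?_
        norm_num
        ring
      exact h1.comp_hasFDerivAt v
        ((ContinuousLinearMap.proj j : (Fin n → ℝ) →L[ℝ] ℝ).hasFDerivAt)
    have h := (hS.neg.exp).const_mul (-Real.exp (-η * x))
    rw [e]
    refine h.congr_fderiv ?_
    ext w
    simp
    ring
  have hv1 : ∀ t x v i, fderiv ℝ (u t x) v (Pi.single i 1)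
      = -u t x v * (φ i t * v i + ψ i t) := by
    intro t x v i
    rw [(hv t x v).fderiv]
    simp [Pi.single_apply]
  have hv2 : ∀ t x v i, fderiv ℝ (fun w => fderiv ℝ (u t x) w (Pi.single i 1)) v (Pi.single i 1)
      = u t x v * ((φ i t * v i + ψ i t) ^ 2 - φ i t) := by
    intro t x v i
    simp only [hv1]
    have h1 : HasFDerivAt (fun w : Fin n → ℝ => φ i t * w i + ψ i t)
        (φ i t • (ContinuousLinearMap.proj i : (Fin n → ℝ) →L[ℝ] ℝ)) v :=
      (((ContinuousLinearMap.proj i : (Fin n → ℝ) →L[ℝ] ℝ).hasFDerivAt).const_mul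
        (φ i t)).add_const (ψ i t)
    have h2 := ((hv t x v).fun_neg).fun_mul h1
    have h3 := hv1 t x v i
    rw [(hv t x v).fderiv] at h3
    rw [h2.fderiv]
    simp only [_root_.add_apply, _root_.smul_apply, _root_.neg_apply] at h3 ⊢
    rw [h3]
    simp
    ring
  refine ⟨fun t _ x v => ⟨hx2 t x v, ?_⟩, ?_, ?_⟩
  · have := hne t x v
    exact mul_neg_of_pos_of_neg (by positivity) this
  · intro x v
    rw [hu]
    simp [hφT, hψT, hχT]
  · intro t ht x v
    have htd : HasDerivAt (fun s => u s x v) (-u t x v * ∑ i,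
        ((2 * κ i * φ i t + (ν i) ^ 2 * (φ i t) ^ 2 - (lam i) ^ 2) * (v i) ^ 2 / 2
        + ((κ i + (ν i) ^ 2 * φ i t) * ψ i t - κ i * θ i * φ i t) * v i
        + (-(κ i * θ i) * ψ i t + (ν i) ^ 2 / 2 * (-(φ i t) + (ψ i t) ^ 2)))) t := by
      simp only [hu]
      have hS := HasDerivAt.fun_sum (u := Finset.univ) (fun i _ =>
        ((((hφ i t ht).mul_const ((v i) ^ 2)).div_const 2).fun_add
          ((hψ i t ht).mul_const (v i))).fun_add (hχ i t ht))
      refine ((hS.fun_neg.exp).const_mul (-Real.exp (-η * x))).congr_deriv ?_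
      ring
    rw [htd.deriv, hx2, hx1]
    simp only [hv2]
    simp only [hv1]
    have hu0 : u t x v ≠ 0 := (hne t x v).ne
    have hr : 1 / 2 * (∑ i, (lam i) ^ 2 * (v i) ^ 2) * (-η * u t x v) ^ 2 / (η ^ 2 * u t x v)
        = ∑ i, (lam i) ^ 2 * (v i) ^ 2 * (u t x v / 2) := by
      rw [← Finset.sum_mul]
      field_simp
    rw [hr, Finset.mul_sum, ← Finset.sum_add_distrib]
    refine Finset.sum_congr rfl fun i _ => ?_
    ring
end

section
/- Let λ, κ, ν ∈ ℝ with κ̂ := √(κ² + ν²λ²) > 0, and let T > 0. Define φ : [0,T] → ℝ by φ(t) = λ²·sinh(κ̂(T−t)) / (κ·sinh(κ̂(T−t)) + κ̂·cosh(κ̂(T−t))). Then the denominator κ·sinh(κ̂(T−t)) + κ̂·cosh(κ̂(T−t)) is strictly positive for all t ∈ [0,T], and φ satisfies the Riccati ordinary differential equation φ'(t) = 2κφ(t) + ν²φ(t)² − λ² for all t ∈ [0,T], with terminal condition φ(T) = 0. -/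
theorem stmt_18 (lam κ ν : ℝ) (κh : ℝ)
    (hκh : κh = Real.sqrt (κ ^ 2 + ν ^ 2 * lam ^ 2)) (hκhpos : 0 < κh)
    (T : ℝ) (hT : 0 < T)
    (φ : ℝ → ℝ)
    (hφ : ∀ t, φ t = lam ^ 2 * Real.sinh (κh * (T - t))
        / (κ * Real.sinh (κh * (T - t)) + κh * Real.cosh (κh * (T - t)))) :
    (∀ t ∈ Set.Icc (0:ℝ) T,
      0 < κ * Real.sinh (κh * (T - t)) + κh * Real.cosh (κh * (T - t)) ∧
      HasDerivAt φ (2 * κ * φ t + ν ^ 2 * (φ t) ^ 2 - lam ^ 2) t) ∧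
    φ T = 0 := by
  have hsq : κh ^ 2 = κ ^ 2 + ν ^ 2 * lam ^ 2 := by
    rw [hκh, Real.sq_sqrt (by positivity)]
  refine ⟨fun t ht => ?_, by simp [hφ]⟩
  have hk : -κh ≤ κ := by
    have h : |κ| ≤ κh := by
      rw [hκh]
      exact Real.abs_le_sqrt (by nlinarith [sq_nonneg (ν * lam)])
    exact (abs_le.mp h).1
  have hs : 0 ≤ Real.sinh (κh * (T - t)) :=
    Real.sinh_nonneg_iff.mpr (mul_nonneg hκhpos.le (sub_nonneg.mpr ht.2))
  have hcs : Real.sinh (κh * (T - t)) < Real.cosh (κh * (T - t)) := Real.sinh_lt_cosh _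
  have hid := Real.cosh_sq (κh * (T - t))
  have hD : 0 < κ * Real.sinh (κh * (T - t)) + κh * Real.cosh (κh * (T - t)) := by
    nlinarith [mul_le_mul_of_nonneg_right hk hs, mul_lt_mul_of_pos_left hcs hκhpos]
  refine ⟨hD, ?_⟩
  have hf : HasDerivAt (fun t : ℝ => κh * (T - t)) (-κh) t := by
    simpa using ((hasDerivAt_id t).const_sub T).const_mul κh
  have h1 := hf.sinh
  have h2 := hf.cosh
  have h3 := (h1.const_mul (lam ^ 2)).div ((h1.const_mul κ).add (h2.const_mul κh)) hD.ne'
  have h4 : HasDerivAt φ _ t := h3.congr_of_eventuallyEq (Filter.Eventually.of_forall hφ)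
  refine h4.congr_deriv ?_
  rw [hφ t]
  simp only [Pi.add_apply]
  generalize Real.sinh (κh * (T - t)) = s at *
  generalize Real.cosh (κh * (T - t)) = c at *
  have hn := hD.ne'
  generalize hd : κ * s + κh * c = D at *
  field_simp
  subst hd
  have hν : ν ^ 2 * lam ^ 2 = κh ^ 2 - κ ^ 2 := by linarith
  first
  | linear_combination (-s^2) * hν
  | linear_combination (-lam^2 * s^2) * hν
  | skip
end
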